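/- Let ω = e^{iπ/4}, let z ∈ ℂ with 0 < Re(ωz) < 1/√2, and let L be the line ζ = ωu, u ∈ ℝ. Then ∫_L e^{-zζ}/(1+e^{-ζ}) dζ - ∫_{L+2πi} e^{-zζ}/(1+e^{-ζ}) dζ = 2πi e^{-πiz}, where the right side is 2πi times the residue of e^{-zζ}/(1+e^{-ζ}) at ζ = πi. -/

import Mathlib

open Complex MeasureTheory Set

noncomputable section

/-- `ω = e^{iπ/4}`. -/
def ω : ℂ := Complex.exp (Real.pi * Complex.I / 4)

/-- Hermite function of complex order `ν`, defined by its power series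
(Lebedev (10.4.3)): `H_ν(z) = (1/(2Γ(-ν))) Σ_n Γ((n-ν)/2)(-2z)^n/n!`. -/
def HermiteF (ν z : ℂ) : ℂ :=
  (1 / (2 * Complex.Gamma (-ν))) *
    ∑' n : ℕ, Complex.Gamma (((n : ℂ) - ν) / 2) * (-2 * z) ^ n / (Nat.factorial n : ℂ)

/-- Riemann's auxiliary function `ℛ(s) = ∫_{0↙1} x^{-s} e^{πix²}/(e^{πix}-e^{-πix}) dx`,
with the path parametrized as `x = 1/2 - ω u`, `u ∈ ℝ`, so `dx = -ω du`. -/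
def RiemannR (s : ℂ) : ℂ :=
  ∫ u : ℝ, (-ω) * ((1 / 2 - ω * u) ^ (-s) *
      Complex.exp (Real.pi * Complex.I * (1 / 2 - ω * u) ^ 2) /
    (Complex.exp (Real.pi * Complex.I * (1 / 2 - ω * u)) -
      Complex.exp (-(Real.pi : ℂ) * Complex.I * (1 / 2 - ω * u))))

/-- Parabolic cylinder function `U(a,z)`, expressed through the Hermite function via
`U(-ν-1/2,z) = 2^{-ν/2} e^{-z²/4} H_ν(z/√2)`. -/
def cylinderU (a z : ℂ) : ℂ :=
  (2 : ℂ) ^ (a / 2 + 1 / 4) * Complex.exp (-z ^ 2 / 4) *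
    HermiteF (-a - 1 / 2) (z / (Real.sqrt 2 : ℂ))

/-- Whittaker's parabolic cylinder function `D_ν(z) = U(-ν-1/2, z)`. -/
def whittakerD (ν z : ℂ) : ℂ := cylinderU (-ν - 1 / 2) z

open Filter Topology

def fz (z v : ℂ) : ℂ := ω * (Complex.exp (-z * (ω * v)) / (1 + Complex.exp (-(ω * v))))

lemma omega_eq : ω = (((Real.sqrt 2 / 2 : ℝ) : ℂ)) + ((Real.sqrt 2 / 2 : ℝ) : ℂ) * I := by
  unfold ω
  rw [show (Real.pi : ℂ) * I / 4 = ((Real.pi / 4 : ℝ) : ℂ) * I by push_cast; ring]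
  rw [Complex.exp_mul_I, ← Complex.ofReal_cos, ← Complex.ofReal_sin, Real.cos_pi_div_four,
    Real.sin_pi_div_four]

lemma omega_re : ω.re = Real.sqrt 2 / 2 := by rw [omega_eq]; simp
lemma omega_im : ω.im = Real.sqrt 2 / 2 := by rw [omega_eq]; simp

lemma omega_norm : ‖ω‖ = 1 := by
  unfold ω
  rw [show (Real.pi : ℂ) * I / 4 = ((Real.pi / 4 : ℝ) : ℂ) * I by push_cast; ring]
  exact Complex.norm_exp_ofReal_mul_I _

lemma omega_ne : ω ≠ 0 := Complex.exp_ne_zero _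

def bb : ℝ := Real.sqrt 2 * Real.pi
def pp : ℂ := (bb / 2 : ℝ) + (bb / 2 : ℝ) * I

lemma bb_pos : 0 < bb := by unfold bb; positivity

lemma omega_mul_pp : ω * pp = Real.pi * I := by
  have h2 : Real.sqrt 2 * Real.sqrt 2 = 2 := Real.mul_self_sqrt (by norm_num)
  rw [omega_eq, pp, bb]
  apply Complex.ext
  · simp
  · simp
    linear_combination Real.pi / 2 * h2

/-- the denominator vanishes only at `pp` in the strip. -/
lemma den_zero {v : ℂ} (h1 : -(bb / 2) < v.im) (h2 : v.im < 3 * bb / 2)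
    (h : 1 + Complex.exp (-(ω * v)) = 0) : v = pp := by
  have h3 : Complex.exp (ω * (pp - v)) = 1 := by
    rw [mul_sub, sub_eq_add_neg, Complex.exp_add, omega_mul_pp, Complex.exp_pi_mul_I]
    linear_combination -h
  obtain ⟨n, hn⟩ := Complex.exp_eq_one_iff.1 h3
  have h4 : pp - v = 2 * n * pp := by
    apply mul_left_cancel₀ omega_ne
    rw [hn]; linear_combination -2 * n * omega_mul_pp
  have h5 : (pp - v).im = 2 * n * (bb / 2) := by
    rw [h4]; simp [pp]
  have h6 : (pp - v).im = bb / 2 - v.im := by simp [pp]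
  have hb := bb_pos
  have h7 : (n : ℝ) < 1 := by nlinarith
  have h8 : (-1 : ℝ) < n := by nlinarith
  have h9 : n = 0 := by
    have : n < 1 := by exact_mod_cast h7
    have : -1 < n := by exact_mod_cast h8
    omega
  subst h9
  simp at h4
  exact (sub_eq_zero.1 h4).symm

lemma omega_mul_re (v : ℂ) : (ω * v).re = Real.sqrt 2 / 2 * (v.re - v.im) := by
  rw [Complex.mul_re, omega_re, omega_im]; ring

lemma fz_norm (z v : ℂ) : ‖fz z v‖ =
    Real.exp (-((ω * z).re * v.re) + (ω * z).im * v.im) / ‖1 + Complex.exp (-(ω * v))‖ := by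
  unfold fz
  rw [norm_mul, omega_norm, one_mul, norm_div, Complex.norm_exp]
  congr 2
  rw [show -z * (ω * v) = -((ω * z) * v) by ring, Complex.neg_re, Complex.mul_re]; ring

lemma num_le (z v : ℂ) (h0 : 0 ≤ v.im) (h1 : v.im ≤ bb) :
    Real.exp (-((ω * z).re * v.re) + (ω * z).im * v.im) ≤
      Real.exp (|(ω * z).im| * bb) * Real.exp (-((ω * z).re * v.re)) := by
  rw [← Real.exp_add, Real.exp_le_exp]
  have : (ω * z).im * v.im ≤ |(ω * z).im| * bb :=
    mul_le_mul (le_abs_self _) h1 h0 (abs_nonneg _)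
  linarith

lemma two_le_exp {x : ℝ} (h : 1 ≤ x) : 2 ≤ Real.exp x := by
  have := Real.add_one_le_exp x
  linarith

lemma sqrt_two_ge : 1 ≤ Real.sqrt 2 := by
  rw [Real.one_le_sqrt]; norm_num

lemma fz_top (z v : ℂ) (h0 : 0 ≤ v.im) (h1 : v.im ≤ bb) (h : bb + 2 ≤ v.re) :
    ‖fz z v‖ ≤ 2 * Real.exp (|(ω * z).im| * bb) * Real.exp (-(ω * z).re * v.re) := by
  have hd : 1 / 2 ≤ ‖1 + Complex.exp (-(ω * v))‖ := by
    have e1 : ‖Complex.exp (-(ω * v))‖ ≤ 1 / 2 := by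
      rw [Complex.norm_exp, Complex.neg_re, Real.exp_neg, omega_mul_re, one_div]
      apply inv_anti₀ two_pos
      apply two_le_exp
      nlinarith [sqrt_two_ge]
    have e2 := norm_sub_le (1 + Complex.exp (-(ω * v))) (Complex.exp (-(ω * v)))
    simp only [add_sub_cancel_right, norm_one] at e2
    linarith
  rw [fz_norm, div_le_iff₀ (by linarith)]
  refine (num_le z v h0 h1).trans ?_
  rw [neg_mul]
  nlinarith [mul_pos (Real.exp_pos (|(ω * z).im| * bb)) (Real.exp_pos (-((ω * z).re * v.re)))]

lemma fz_bot (z v : ℂ) (h0 : 0 ≤ v.im) (h1 : v.im ≤ bb) (h : v.re ≤ -2) :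
    ‖fz z v‖ ≤ 2 * Real.exp (|(ω * z).im| * bb) *
      Real.exp ((Real.sqrt 2 / 2 - (ω * z).re) * v.re) := by
  have hd : Real.exp (-(Real.sqrt 2 / 2 * v.re)) / 2 ≤ ‖1 + Complex.exp (-(ω * v))‖ := by
    have e0 : Real.exp (-(Real.sqrt 2 / 2 * v.re)) ≤ ‖Complex.exp (-(ω * v))‖ := by
      rw [Complex.norm_exp, Complex.neg_re, omega_mul_re, Real.exp_le_exp]
      nlinarith [sqrt_two_ge]
    have e1 : 2 ≤ Real.exp (-(Real.sqrt 2 / 2 * v.re)) := by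
      apply two_le_exp
      nlinarith [sqrt_two_ge]
    have e2 := norm_sub_le (1 + Complex.exp (-(ω * v))) 1
    simp only [add_sub_cancel_left, norm_one] at e2
    linarith
  rw [fz_norm, div_le_iff₀ (lt_of_lt_of_le (by positivity) hd)]
  refine (num_le z v h0 h1).trans ?_
  refine le_trans ?_ (mul_le_mul_of_nonneg_left hd (by positivity))
  have e : Real.exp (-((ω * z).re * v.re)) = Real.exp ((Real.sqrt 2 / 2 - (ω * z).re) * v.re) *
      Real.exp (-(Real.sqrt 2 / 2 * v.re)) := by
    rw [← Real.exp_add]; congr 1; ring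
  rw [e]
  apply le_of_eq; ring

lemma fz_cont (z : ℂ) : Continuous (fun u : ℝ => fz z u) := by
  unfold fz
  refine continuous_const.mul (Continuous.div (by fun_prop) (by fun_prop) ?_)
  intro u h
  have hb := bb_pos
  have := den_zero (by simp; linarith) (by simp; linarith) h
  have := congrArg Complex.im this
  simp [pp] at this
  linarith

lemma fz_integrable (z : ℂ) (h0 : 0 < (ω * z).re) (h1 : (ω * z).re < Real.sqrt 2 / 2) :
    Integrable (fun u : ℝ => fz z u) := by
  have hb := bb_pos
  refine (fz_cont z).locallyIntegrable.integrable_of_isBigO_atBot_atTop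
    (g := fun u => Real.exp ((Real.sqrt 2 / 2 - (ω * z).re) * u))
    (g' := fun u => Real.exp (-(ω * z).re * u)) ?_ ?_ ?_ ?_
  · refine Asymptotics.IsBigO.of_bound (2 * Real.exp (|(ω * z).im| * bb)) ?_
    filter_upwards [eventually_le_atBot (-2)] with u hu
    have := fz_bot z u (by simp) (by simpa using hb.le) (by simpa using hu)
    simpa [abs_of_pos (Real.exp_pos _)] using this
  · exact ⟨_, Iic_mem_atBot 0, integrableOn_exp_mul_Iic (by linarith) 0⟩
  · refine Asymptotics.IsBigO.of_bound (2 * Real.exp (|(ω * z).im| * bb)) ?_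
    filter_upwards [eventually_ge_atTop (bb + 2)] with u hu
    have := fz_top z u (by simp) (by simpa using hb.le) (by simpa using hu)
    simpa [abs_of_pos (Real.exp_pos _)] using this
  · exact ⟨_, Ioi_mem_atTop 0, exp_neg_integrableOn_Ioi 0 h0⟩

def kk (x : ℝ) : ℂ := 1 / ((x : ℂ) - pp) - 1 / ((x : ℂ) + bb * I - pp)

lemma kk_eq (x : ℝ) : kk x = ((4 / bb : ℝ) * I) * (((1 + ((2 / bb) * (x - bb / 2)) ^ 2)⁻¹ : ℝ) : ℂ) := by
  have hb := bb_pos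
  have hb' : (bb : ℂ) ≠ 0 := by exact_mod_cast hb.ne'
  have h1 : (x : ℂ) - pp ≠ 0 := by
    intro h; have := congrArg Complex.im h; simp [pp] at this; linarith
  have h2 : (x : ℂ) + bb * I - pp ≠ 0 := by
    intro h; have := congrArg Complex.im h; simp [pp] at this; linarith
  have h3 : (((1 + ((2 / bb) * (x - bb / 2)) ^ 2) : ℝ) : ℂ) ≠ 0 := by
    have : 0 < 1 + ((2 / bb) * (x - bb / 2)) ^ 2 := by positivity
    exact_mod_cast this.ne'
  have h4 : ((x : ℂ) - pp) * ((x : ℂ) + bb * I - pp) =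
      (bb : ℂ) ^ 2 / 4 * (((1 + ((2 / bb) * (x - bb / 2)) ^ 2) : ℝ) : ℂ) := by
    unfold pp; push_cast; field_simp; ring_nf; simp only [I_sq]; ring
  unfold kk
  rw [div_sub_div _ _ h1 h2, h4, Complex.ofReal_inv]
  push_cast at h3 ⊢
  field_simp
  ring

lemma kk_integrable : Integrable kk := by
  have hb := bb_pos
  rw [funext kk_eq]
  have := (integrable_inv_one_add_sq.comp_mul_left' (R := 2 / bb) (by positivity)).comp_sub_right (bb / 2)
  exact this.ofReal.const_mul _

lemma kk_integral : ∫ x, kk x = 2 * Real.pi * I := by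
  have hb := bb_pos
  have hb' : (bb : ℂ) ≠ 0 := by exact_mod_cast hb.ne'
  rw [funext kk_eq, integral_const_mul, integral_complex_ofReal]
  rw [integral_sub_right_eq_self (fun x : ℝ => (1 + ((2 / bb) * x) ^ 2)⁻¹)]
  rw [Measure.integral_comp_mul_left (fun x : ℝ => (1 + x ^ 2)⁻¹), integral_univ_inv_one_add_sq]
  rw [abs_of_pos (by positivity)]
  simp only [smul_eq_mul]
  push_cast
  field_simp
  ring

def strip : Set ℂ := {v | -(bb / 2) < v.im ∧ v.im < 3 * bb / 2}

lemma strip_open : IsOpen strip :=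
  (isOpen_lt continuous_const Complex.continuous_im).inter
    (isOpen_lt Complex.continuous_im continuous_const)

lemma pp_mem : pp ∈ strip := by
  have hb := bb_pos
  constructor <;> simp [pp] <;> linarith

lemma exists_reg (z : ℂ) : ∃ h : ℂ → ℂ, DifferentiableOn ℂ h strip ∧
    ∀ v, v ≠ pp → h v = fz z v - Complex.exp (-Real.pi * I * z) * (1 / (v - pp)) := by
  let D : ℂ → ℂ := fun v => 1 + Complex.exp (-(ω * v))
  have hDp : D pp = 0 := by
    simp only [D]; rw [omega_mul_pp, Complex.exp_neg, Complex.exp_pi_mul_I]; norm_num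
  have hD : Differentiable ℂ D := by simp only [D]; fun_prop
  have hD' : deriv D pp = ω := by
    have : HasDerivAt D (Complex.exp (-(ω * pp)) * (-(ω * 1))) pp :=
      ((((hasDerivAt_id pp).const_mul ω).neg).cexp).const_add 1
    rw [this.deriv, omega_mul_pp, Complex.exp_neg, Complex.exp_pi_mul_I]; norm_num
  let q := dslope D pp
  have hqd : DifferentiableOn ℂ q strip :=
    (Complex.differentiableOn_dslope (strip_open.mem_nhds pp_mem)).2 hD.differentiableOn
  have hq : ∀ v, v ≠ pp → q v = D v / (v - pp) := by
    intro v hv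
    simp only [q]
    rw [dslope_of_ne _ hv, slope_def_field, hDp, sub_zero]
  have hqp : q pp = ω := by simp only [q]; rw [dslope_same, hD']
  have hq0 : ∀ v ∈ strip, q v ≠ 0 := by
    intro v hv
    by_cases h : v = pp
    · rw [h, hqp]; exact omega_ne
    · rw [hq v h]
      exact div_ne_zero (fun h' => h (den_zero hv.1 hv.2 h')) (sub_ne_zero.2 h)
  let G : ℂ → ℂ := fun v => ω * Complex.exp (-z * (ω * v)) / q v
  have hG : DifferentiableOn ℂ G strip := by
    apply DifferentiableOn.div _ hqd hq0
    fun_prop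
  refine ⟨dslope G pp, (Complex.differentiableOn_dslope (strip_open.mem_nhds pp_mem)).2 hG, ?_⟩
  intro v hv
  have hv' := sub_ne_zero.2 hv
  rw [dslope_of_ne _ hv, slope_def_field]
  simp only [G]
  rw [hqp, hq v hv, omega_mul_pp, mul_div_cancel_left₀ _ omega_ne,
    show -z * (Real.pi * I) = -Real.pi * I * z by ring]
  simp only [fz, D]
  by_cases h : 1 + Complex.exp (-(ω * v)) = 0
  · rw [h]; simp; ring
  · field_simp

lemma fz_shift (z v : ℂ) : fz z (v + 2 * pp) = Complex.exp (-2 * Real.pi * I * z) * fz z v := by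
  have h : ω * (v + 2 * pp) = ω * v + 2 * Real.pi * I := by
    linear_combination 2 * omega_mul_pp
  unfold fz
  rw [h, neg_add, Complex.exp_add (-(ω * v)), Complex.exp_neg (2 * Real.pi * I),
    Complex.exp_two_pi_mul_I, inv_one, mul_one, mul_add, Complex.exp_add,
    show -z * (2 * Real.pi * I) = -2 * Real.pi * I * z by ring]
  ring

lemma side_tendsto (h : ℂ → ℂ) (e : ℝ → ℝ) (B : ℝ → ℝ) (hB : Tendsto B atTop (𝓝 0))
    (hh : ∀ᶠ R in atTop, ∀ y : ℝ, 0 ≤ y → y ≤ bb → ‖h (e R + y * I)‖ ≤ B R) :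
    Tendsto (fun R => ∫ y in (0 : ℝ)..bb, h (e R + y * I)) atTop (𝓝 0) := by
  have hb := bb_pos
  refine squeeze_zero_norm' (a := fun R => B R * |bb - 0|) ?_ (by simpa using hB.mul_const (|bb - 0|))
  filter_upwards [hh] with R hR
  apply intervalIntegral.norm_integral_le_of_norm_le_const
  intro y hy
  rw [uIoc_of_le hb.le] at hy
  exact hR y hy.1.le hy.2

lemma pole_bound {v : ℂ} {d : ℝ} (hd : 0 < d) (h : d ≤ |v.re - bb / 2|) : ‖1 / (v - pp)‖ ≤ d⁻¹ := by
  rw [norm_div, norm_one, one_div]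
  apply inv_anti₀ hd
  refine h.trans ?_
  have := Complex.abs_re_le_norm (v - pp)
  simpa [pp] using this

lemma main_aux (z : ℂ) (h0 : 0 < (ω * z).re) (h1 : (ω * z).re < Real.sqrt 2 / 2) :
    (∫ u : ℝ, fz z u) - Complex.exp (-2 * Real.pi * I * z) * (∫ u : ℝ, fz z u) =
    2 * Real.pi * I * Complex.exp (-Real.pi * I * z) := by
  have hb := bb_pos
  obtain ⟨h, hd, hh⟩ := exists_reg z
  set c := Complex.exp (-Real.pi * I * z) with hc
  set E := Complex.exp (-2 * Real.pi * I * z) with hE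
  have hne : ∀ v : ℂ, v.im ≠ bb / 2 → v ≠ pp := by
    intro v hv h; apply hv; rw [h]; simp [pp]
  have hne' : ∀ v : ℂ, v.re ≠ bb / 2 → v ≠ pp := by
    intro v hv h; apply hv; rw [h]; simp [pp]
  have hi := fz_integrable z h0 h1
  have hi2 : Integrable (fun u : ℝ => fz z ((u - bb : ℝ) : ℂ)) := hi.comp_sub_right bb
  let H : ℝ → ℂ := fun x => fz z x - E * fz z ((x - bb : ℝ) : ℂ) - c * kk x
  have hH : ∀ x : ℝ, H x = h x - h (x + bb * I) := by
    intro x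
    rw [hh x (hne _ (by simp; linarith)), hh (x + bb * I) (hne _ (by simp; linarith))]
    have : (x : ℂ) + bb * I = ((x - bb : ℝ) : ℂ) + 2 * pp := by
      unfold pp; push_cast; ring
    simp only [H, kk]
    conv_rhs => enter [2, 1]; rw [this, fz_shift]
    ring
  have hHint : Integrable H := (hi.sub (hi2.const_mul E)).sub (kk_integrable.const_mul c)
  have hHval : ∫ x, H x = (∫ u : ℝ, fz z u) - E * (∫ u : ℝ, fz z u) - c * (2 * Real.pi * I) := by
    simp only [H]
    rw [integral_sub (f := fun x : ℝ => fz z x - E * fz z ((x - bb : ℝ) : ℂ))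
        (hi.sub (hi2.const_mul E)) (kk_integrable.const_mul c),
      integral_sub hi (hi2.const_mul E), integral_const_mul, integral_const_mul, kk_integral,
      integral_sub_right_eq_self (fun u : ℝ => fz z u)]
  have hlim := intervalIntegral_tendsto_integral hHint tendsto_neg_atTop_atBot tendsto_id
  -- the rectangle
  have hcont : ∀ y : ℝ, 0 ≤ y → y ≤ bb → Continuous (fun x : ℝ => h (x + y * I)) := by
    intro y hy hy'
    apply hd.continuousOn.comp_continuous (by fun_prop)
    intro x
    constructor <;> simp <;> linarith
  have hrect : ∀ R : ℝ, ∫ x in (-R)..R, H x =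
      I * (∫ y in (0 : ℝ)..bb, h ((-R : ℝ) + y * I)) - I * (∫ y in (0 : ℝ)..bb, h (R + y * I)) := by
    intro R
    have := Complex.integral_boundary_rect_eq_zero_of_differentiableOn h ((-R : ℝ) : ℂ) (R + bb * I)
      (hd.mono (by
        intro v hv
        have := hv.2
        simp only [mem_preimage] at this
        rw [uIcc_of_le (by simpa using hb.le)] at this
        simp at this
        constructor <;> linarith))
    simp only [smul_eq_mul, Complex.add_re, Complex.ofReal_re, Complex.mul_re, Complex.I_re,
      Complex.I_im, Complex.ofReal_im, Complex.add_im, Complex.mul_im, mul_zero, mul_one, zero_mul,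
      sub_zero, add_zero, zero_add, Complex.ofReal_zero, sub_self] at this
    have c0 := hcont 0 le_rfl hb.le
    simp only [Complex.ofReal_zero, zero_mul, add_zero] at c0
    rw [intervalIntegral.integral_congr (fun x _ => hH x),
      intervalIntegral.integral_sub (c0.intervalIntegrable _ _)
        ((hcont bb hb.le le_rfl).intervalIntegrable _ _)]
    linear_combination this
  have hpole : Tendsto (fun R : ℝ => ‖c‖ * (R - bb)⁻¹) atTop (𝓝 0) := by
    simpa [sub_eq_add_neg] using (tendsto_inv_atTop_zero.comp
      (tendsto_atTop_add_const_right atTop (-bb) tendsto_id)).const_mul ‖c‖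
  have hexp : ∀ t : ℝ, 0 < t → Tendsto
      (fun R : ℝ => 2 * Real.exp (|(ω * z).im| * bb) * Real.exp (-t * R)) atTop (𝓝 0) := by
    intro t ht
    have : Tendsto (fun R : ℝ => Real.exp (-t * R)) atTop (𝓝 0) :=
      Real.tendsto_exp_atBot.comp (tendsto_id.const_mul_atTop_of_neg (by linarith))
    simpa using this.const_mul (2 * Real.exp (|(ω * z).im| * bb))
  have hR := side_tendsto h (fun R => R) _
    (by simpa using (hexp _ h0).add hpole) (by
      filter_upwards [eventually_ge_atTop (bb + 2)] with R hR y hy hy'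
      rw [hh _ (hne' _ (by simp; linarith))]
      refine (norm_sub_le _ _).trans (add_le_add ?_ ?_)
      · simpa using fz_top z (R + y * I) (by simpa using hy) (by simpa using hy') (by simpa using hR)
      · rw [norm_mul]
        apply mul_le_mul_of_nonneg_left _ (norm_nonneg _)
        apply pole_bound (d := R - bb) (by linarith)
        simp
        linarith [le_abs_self (R - bb / 2)])
  have hL := side_tendsto h (fun R => -R) _
    (by simpa using (hexp _ (sub_pos.2 h1)).add hpole) (by
      filter_upwards [eventually_ge_atTop (bb + 2)] with R hR y hy hy'
      rw [hh _ (hne' _ (by simp; linarith))]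
      refine (norm_sub_le _ _).trans (add_le_add ?_ ?_)
      · have := fz_bot z ((-R : ℝ) + y * I) (by simpa using hy) (by simpa using hy')
          (by simp; linarith)
        refine this.trans (le_of_eq ?_)
        congr 2; simp; ring
      · rw [norm_mul]
        apply mul_le_mul_of_nonneg_left _ (norm_nonneg _)
        apply pole_bound (d := R - bb) (by linarith)
        simp
        linarith [neg_le_abs (-R - bb / 2)])
  have hlim0 : Tendsto (fun R : ℝ => ∫ x in (-R)..R, H x) atTop (𝓝 0) := by
    simp only [hrect]
    simpa using (hL.const_mul I).sub (hR.const_mul I)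
  have := tendsto_nhds_unique hlim hlim0
  rw [hHval] at this
  linear_combination this

theorem integral_diff_shifted_line (z : ℂ) (h0 : 0 < (ω * z).re)
    (h1 : (ω * z).re < (Real.sqrt 2)⁻¹) :
    (∫ u : ℝ, ω * (Complex.exp (-z * (ω * u)) / (1 + Complex.exp (-(ω * u))))) -
      (∫ u : ℝ, ω * (Complex.exp (-z * (ω * u + 2 * Real.pi * Complex.I)) /
        (1 + Complex.exp (-(ω * u + 2 * Real.pi * Complex.I))))) =
    2 * Real.pi * Complex.I * Complex.exp (-Real.pi * Complex.I * z) := by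
  have h1' : (ω * z).re < Real.sqrt 2 / 2 := by
    rwa [Real.sqrt_div_self', one_div]
  rw [← main_aux z h0 h1', ← integral_const_mul]
  congr 1
  apply integral_congr_ae
  refine Eventually.of_forall fun u => ?_
  simp only
  rw [← fz_shift, fz, show ω * ((u : ℂ) + 2 * pp) = ω * u + 2 * Real.pi * I by
    linear_combination 2 * omega_mul_pp]
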